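/- arXiv:1708.00944 — 2 statements merged into one kernel-verified Lean document; each statement's English description precedes it below -/
import Mathlib

section
/- Let 𝔽 be a field and f = g/h ∈ 𝔽(X) in lowest terms of degree d ≥ 2, not a monomial, not of the form aX^{p^ℓ}+b, and not linearly conjugate to 1/X^d, with deg g > deg h ≥ 1 or 1 ≤ deg g < deg h. Then for every n ≥ 1 and integers k_1,…,k_n with k_n ≠ 0, the degree of (f^(1))^{k_1}⋯(f^(n))^{k_n} is at least d^{n−1}. -/
open Polynomial

/-- Composition of rational functions: `rcomp u v = u ∘ v`. -/
noncomputable def rcomp {F : Type*} [Field F] (u v : RatFunc F) : RatFunc F :=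
  RatFunc.eval (algebraMap F (RatFunc F)) v u

/-- Iterates of a rational function: `riter f 0 = X`, `riter f (k+1) = f ∘ (riter f k)`. -/
noncomputable def riter {F : Type*} [Field F] (f : RatFunc F) : ℕ → RatFunc F
  | 0 => RatFunc.X
  | k + 1 => rcomp f (riter f k)

/-- Degree of a rational function (written in lowest terms as `num/denom`). -/
noncomputable def rdeg {F : Type*} [Field F] (f : RatFunc F) : ℕ :=
  max f.num.natDegree f.denom.natDegree

open Function in
/-- A dynamical lemma: if the orbit of `w` is `w, w, …` or `w, z, φ z, …`, and both `z` and `w` have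
a preimage other than `w`, then one of these preimages avoids the forward orbits of `z` and `w`. -/
theorem exists_preimage_avoiding_orbits {T : Type*} (φ : T → T) {z w b₁ b₂ : T} (hzw : z ≠ w)
    (hφ : φ w = w ∨ φ w = z) (hb₁ : b₁ ≠ w) (h₁ : φ b₁ = z) (hb₂ : b₂ ≠ w) (h₂ : φ b₂ = w) :
    ∃ b, (φ b = z ∨ φ b = w) ∧ (∀ i, φ^[i] z ≠ b) ∧ ∀ i, φ^[i] w ≠ b := by
  have key : ∀ b, b ≠ w → (∀ i, φ^[i] z ≠ b) → ∀ i, φ^[i] w ≠ b := by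
    intro b hb hz i
    rcases hφ with h | h
    · rw [iterate_fixed h]
      exact hb.symm
    · cases i with
      | zero => exact hb.symm
      | succ i =>
        rw [iterate_succ_apply, h]
        exact hz i
  by_cases hw : ∃ m, φ^[m] z = w
  · obtain ⟨m, hm⟩ := hw
    suffices h : ∀ i, φ^[i] z ≠ b₁ from ⟨b₁, Or.inl h₁, h, key b₁ hb₁ h⟩
    intro i hi
    have hper : IsPeriodicPt φ (i + 1) z := by
      rw [IsPeriodicPt, IsFixedPt, iterate_succ_apply', hi, h₁]
    rcases hφ with h | h
    · have e := (hper.mul_const (m + 1)).eq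
      rw [show (i + 1) * (m + 1) = (i * m + i + 1) + m by ring, iterate_add_apply, hm,
        iterate_fixed h] at e
      exact hzw e.symm
    · have hper' : IsPeriodicPt φ (m + 1) z := by
        rw [IsPeriodicPt, IsFixedPt, iterate_succ_apply', hm, h]
      have e₁ : φ^[m + (m + 1) * i] z = w := by
        rw [iterate_add_apply, (hper'.mul_const i).eq, hm]
      have e₂ : φ^[i + (i + 1) * m] z = b₁ := by
        rw [iterate_add_apply, (hper.mul_const m).eq, hi]
      rw [show i + (i + 1) * m = m + (m + 1) * i by ring, e₁] at e₂
      exact hb₁ e₂.symm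
  · push Not at hw
    have h : ∀ i, φ^[i] z ≠ b₂ := by
      intro i hi
      apply hw (i + 1)
      rw [iterate_succ_apply', hi, h₂]
    exact ⟨b₂, Or.inr h₂, h, key b₂ hb₂ h⟩

section Homogeneous

variable {F : Type*} [Field F]

/-- Evaluation at `(a, b)` of the degree `d` homogenization of `p`. -/
noncomputable def homEval {R : Type*} [CommRing R] [Algebra F R] (d : ℕ) (p : F[X]) (a b : R) : R :=
  ∑ i ∈ Finset.range (d + 1), algebraMap F R (p.coeff i) * (a ^ i * b ^ (d - i))

theorem map_homEval {R S : Type*} [CommRing R] [CommRing S] [Algebra F R] [Algebra F S]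
    (σ : R →ₐ[F] S) (d : ℕ) (p : F[X]) (a b : R) :
    σ (homEval d p a b) = homEval d p (σ a) (σ b) := by
  simp [homEval]

theorem homEval_mul_mul {R : Type*} [CommRing R] [Algebra F R] (d : ℕ) (p : F[X]) (c a b : R) :
    homEval d p (c * a) (c * b) = c ^ d * homEval d p a b := by
  rw [homEval, homEval, Finset.mul_sum]
  refine Finset.sum_congr rfl fun i hi => ?_
  obtain ⟨j, rfl⟩ := Nat.exists_eq_add_of_le (Nat.lt_succ_iff.1 (Finset.mem_range.1 hi))
  rw [Nat.add_sub_cancel_left]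
  ring

theorem homEval_one_right {R : Type*} [CommRing R] [Algebra F R] {d : ℕ} {p : F[X]}
    (hp : p.natDegree ≤ d) (a : R) : homEval d p a 1 = aeval a p := by
  rw [homEval, aeval_eq_sum_range' (Nat.lt_succ_of_le hp)]
  simp [Algebra.smul_def]

theorem homEval_one_zero {R : Type*} [CommRing R] [Algebra F R] (d : ℕ) (p : F[X]) :
    homEval d p (1 : R) 0 = algebraMap F R (p.coeff d) := by
  rw [homEval, Finset.sum_eq_single d]
  · simp
  · intro i hi hid
    have : d - i ≠ 0 := by
      have := Finset.mem_range.1 hi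
      omega
    simp [this]
  · simp

theorem homEval_eq_mul_aeval_div {L : Type*} [Field L] [Algebra F L] {d : ℕ} {p : F[X]}
    (hp : p.natDegree ≤ d) (a : L) {b : L} (hb : b ≠ 0) :
    homEval d p a b = b ^ d * aeval (a / b) p := by
  rw [← homEval_one_right hp, ← homEval_mul_mul, mul_div_cancel₀ _ hb, mul_one]

theorem natDegree_homEval_le {d e : ℕ} (p : F[X]) {A B : F[X]} (hA : A.natDegree ≤ e)
    (hB : B.natDegree ≤ e) : (homEval d p A B).natDegree ≤ d * e := by
  refine natDegree_sum_le_of_forall_le _ _ fun i hi => ?_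
  obtain ⟨j, rfl⟩ := Nat.exists_eq_add_of_le (Nat.lt_succ_iff.1 (Finset.mem_range.1 hi))
  rw [Nat.add_sub_cancel_left, add_mul, algebraMap_eq]
  exact (natDegree_C_mul_le _ _).trans (natDegree_mul_le_of_le
    (natDegree_pow_le_of_le i hA) (natDegree_pow_le_of_le j hB))

theorem coeff_homEval {d e : ℕ} (p : F[X]) {A B : F[X]} (hA : A.natDegree ≤ e)
    (hB : B.natDegree ≤ e) :
    (homEval d p A B).coeff (d * e) = homEval d p (A.coeff e) (B.coeff e) := by
  rw [homEval, homEval, finsetSum_coeff]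
  refine Finset.sum_congr rfl fun i hi => ?_
  obtain ⟨j, rfl⟩ := Nat.exists_eq_add_of_le (Nat.lt_succ_iff.1 (Finset.mem_range.1 hi))
  rw [Nat.add_sub_cancel_left, add_mul, algebraMap_eq, coeff_C_mul,
    coeff_mul_add_eq_of_natDegree_le (natDegree_pow_le_of_le i hA) (natDegree_pow_le_of_le j hB),
    mul_comm i, mul_comm j, mul_comm e, mul_comm e, coeff_pow_of_natDegree_le hA,
    coeff_pow_of_natDegree_le hB]
  rfl

theorem sub_dvd_homEval {K : Type*} [Field K] [Algebra F K] {d : ℕ} {p : F[X]}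
    (hp : p.natDegree ≤ d) {b : K} (hb : aeval b p = 0) (A B : K[X]) :
    A - C b * B ∣ homEval d p A B := by
  have h0 : homEval d p (C b * B) B = 0 := by
    have := homEval_mul_mul d p B (C b) 1
    rw [homEval_one_right hp, mul_one, mul_comm B] at this
    rw [this, ← algebraMap_eq, aeval_algebraMap_apply, hb]
    simp
  rw [← sub_zero (homEval d p A B), ← h0, homEval, homEval, ← Finset.sum_sub_distrib]
  refine Finset.dvd_sum fun i _ => ?_
  rw [← mul_sub, ← sub_mul]
  exact ((sub_dvd_pow_sub_pow _ _ i).mul_right _).mul_left _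

/-- The map `(a, b) ↦ (g(a, b), h(a, b))` given by the degree `d` homogenizations of `g`, `h`. -/
noncomputable def homMap {R : Type*} [CommRing R] [Algebra F R] (d : ℕ) (g h : F[X]) (v : R × R) :
    R × R :=
  (homEval d g v.1 v.2, homEval d h v.1 v.2)

theorem map_iterate_homMap {R S : Type*} [CommRing R] [CommRing S] [Algebra F R] [Algebra F S]
    (σ : R →ₐ[F] S) (d : ℕ) (g h : F[X]) (m : ℕ) (v : R × R) :
    Prod.map σ σ ((homMap d g h)^[m] v) = (homMap d g h)^[m] (Prod.map σ σ v) := by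
  refine Function.Semiconj.iterate_right (fun v => ?_) m v
  simp [homMap, map_homEval]

/-- Numerator and denominator of the `m`-th iterate of `g / h`. -/
noncomputable def iterPair (d : ℕ) (g h : F[X]) (m : ℕ) : F[X] × F[X] :=
  (homMap d g h)^[m] (X, 1)

theorem iterPair_succ (d : ℕ) (g h : F[X]) (m : ℕ) :
    iterPair d g h (m + 1) = homMap d g h (iterPair d g h m) :=
  Function.iterate_succ_apply' _ _ _

theorem aeval_iterPair {R : Type*} [CommRing R] [Algebra F R] (d : ℕ) (g h : F[X]) (m : ℕ)
    (x : R) : Prod.map (aeval x) (aeval x) (iterPair d g h m) = (homMap d g h)^[m] (x, 1) := by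
  rw [iterPair, map_iterate_homMap]
  simp

theorem natDegree_iterPair_le (d : ℕ) (g h : F[X]) (m : ℕ) :
    (iterPair d g h m).1.natDegree ≤ d ^ m ∧ (iterPair d g h m).2.natDegree ≤ d ^ m := by
  induction m with
  | zero => simp [iterPair]
  | succ m ih =>
    rw [iterPair_succ, pow_succ']
    exact ⟨natDegree_homEval_le _ ih.1 ih.2, natDegree_homEval_le _ ih.1 ih.2⟩

theorem coeff_iterPair (d : ℕ) (g h : F[X]) (m : ℕ) :
    Prod.map (fun p : F[X] => p.coeff (d ^ m)) (fun p : F[X] => p.coeff (d ^ m)) (iterPair d g h m) =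
      (homMap d g h)^[m] (1, 0) := by
  induction m with
  | zero => simp [iterPair, coeff_one]
  | succ m ih =>
    obtain ⟨h₁, h₂⟩ := natDegree_iterPair_le d g h m
    rw [Function.iterate_succ_apply', ← ih, iterPair_succ, pow_succ']
    simp [homMap, coeff_homEval _ h₁ h₂]

end Homogeneous

section ProjectiveLine

variable {F K : Type*} [Field F] [Field K] [Algebra F K]

open Classical in
/-- The point of the projective line with homogeneous coordinates `v`; `none` is infinity. -/
noncomputable def projPoint (v : K × K) : Option K :=
  if v.2 = 0 then none else some (v.1 / v.2)

/-- A choice of homogeneous coordinates. -/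
def projRep : Option K → K × K
  | none => (1, 0)
  | some a => (a, 1)

theorem projPoint_projRep (t : Option K) : projPoint (projRep t) = t := by
  cases t <;> simp [projPoint, projRep]

theorem projRep_ne_zero (t : Option K) : projRep t ≠ 0 := by
  cases t <;> simp [projRep]

theorem projPoint_smul {c : K} (hc : c ≠ 0) (v : K × K) : projPoint (c • v) = projPoint v := by
  by_cases hv : v.2 = 0
  · simp [projPoint, hv]
  · simp [projPoint, hv, hc, mul_div_mul_left]

theorem exists_eq_smul_projRep {v : K × K} (hv : v ≠ 0) :
    ∃ c : K, c ≠ 0 ∧ v = c • projRep (projPoint v) := by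
  obtain ⟨a, b⟩ := v
  by_cases hb : b = 0
  · subst hb
    refine ⟨a, fun ha => hv (by simp [ha]), by simp [projPoint, projRep]⟩
  · refine ⟨b, hb, ?_⟩
    simp [projPoint, projRep, hb, mul_div_cancel₀]

theorem projPoint_eq_none_iff {v : K × K} : projPoint v = none ↔ v.2 = 0 := by
  simp [projPoint]

theorem projPoint_eq_zero_iff {v : K × K} (hv : v ≠ 0) : projPoint v = some 0 ↔ v.1 = 0 := by
  obtain ⟨c, hc, h⟩ := exists_eq_smul_projRep hv
  rw [h, projPoint_smul hc, projPoint_projRep]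
  cases projPoint v <;> simp [projRep, hc]

/-- The self-map of the projective line given by `g / h`. -/
noncomputable def projMap (d : ℕ) (g h : F[X]) (t : Option K) : Option K :=
  projPoint (homMap d g h (projRep t))

theorem homMap_smul (d : ℕ) (g h : F[X]) (c : K) (v : K × K) :
    homMap d g h (c • v) = c ^ d • homMap d g h v := by
  simp [homMap, homEval_mul_mul]

variable {d : ℕ} {g h : F[X]}

theorem homMap_ne_zero (hgh : IsCoprime g h) (hd : max g.natDegree h.natDegree = d)
    {v : K × K} (hv : v ≠ 0) : homMap d g h v ≠ 0 := by
  obtain ⟨c, hc, e⟩ := exists_eq_smul_projRep hv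
  have hg : g.natDegree ≤ d := hd ▸ le_max_left _ _
  have hh : h.natDegree ≤ d := hd ▸ le_max_right _ _
  rw [e, homMap_smul]
  refine smul_ne_zero (pow_ne_zero _ hc) ?_
  cases projPoint v with
  | none =>
    intro H
    simp only [homMap, projRep, homEval_one_zero, Prod.mk_eq_zero, map_eq_zero] at H
    have hg0 : g.natDegree = d → g = 0 := fun h => leadingCoeff_eq_zero.1 (by
      rw [leadingCoeff, h, H.1])
    have hh0 : h.natDegree = d → h = 0 := fun h' => leadingCoeff_eq_zero.1 (by
      rw [leadingCoeff, h', H.2])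
    rcases max_choice g.natDegree h.natDegree with h' | h'
    · have g0 := hg0 (h'.symm.trans hd)
      have : g.natDegree = 0 := by rw [g0, natDegree_zero]
      rw [g0, hh0 (by omega)] at hgh
      exact not_isCoprime_zero_zero hgh
    · have h0 := hh0 (h'.symm.trans hd)
      have : h.natDegree = 0 := by rw [h0, natDegree_zero]
      rw [h0, hg0 (by omega)] at hgh
      exact not_isCoprime_zero_zero hgh
  | some a =>
    simp only [homMap, projRep, homEval_one_right hg, homEval_one_right hh, ne_eq,
      Prod.mk_eq_zero, not_and_or]
    exact aeval_ne_zero_of_isCoprime hgh a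

theorem projPoint_homMap {v : K × K} (hv : v ≠ 0) :
    projPoint (homMap d g h v) = projMap d g h (projPoint v) := by
  obtain ⟨c, hc, e⟩ := exists_eq_smul_projRep hv
  conv_lhs => rw [e]
  rw [homMap_smul, projPoint_smul (pow_ne_zero _ hc), projMap]

theorem iterate_homMap (hgh : IsCoprime g h) (hd : max g.natDegree h.natDegree = d)
    (m : ℕ) {v : K × K} (hv : v ≠ 0) : (homMap d g h)^[m] v ≠ 0 ∧
      projPoint ((homMap d g h)^[m] v) = (projMap d g h)^[m] (projPoint v) := by
  induction m with
  | zero => exact ⟨hv, rfl⟩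
  | succ m ih =>
    rw [Function.iterate_succ_apply', Function.iterate_succ_apply', projPoint_homMap ih.1, ih.2]
    exact ⟨homMap_ne_zero hgh hd ih.1, rfl⟩

theorem aeval_iterPair_fst_eq_zero_iff (hgh : IsCoprime g h)
    (hd : max g.natDegree h.natDegree = d) (m : ℕ) (x : K) :
    aeval x (iterPair d g h m).1 = 0 ↔ (projMap d g h)^[m] (some x) = some 0 := by
  obtain ⟨h₁, h₂⟩ := iterate_homMap hgh hd m (projRep_ne_zero (some x))
  rw [projPoint_projRep] at h₂
  rw [← h₂, projPoint_eq_zero_iff h₁]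
  exact Iff.of_eq (congrArg (fun v : K × K => v.1 = 0) (aeval_iterPair d g h m x))

theorem aeval_iterPair_snd_eq_zero_iff (hgh : IsCoprime g h)
    (hd : max g.natDegree h.natDegree = d) (m : ℕ) (x : K) :
    aeval x (iterPair d g h m).2 = 0 ↔ (projMap d g h)^[m] (some x) = none := by
  obtain ⟨h₁, h₂⟩ := iterate_homMap hgh hd m (projRep_ne_zero (some x))
  rw [projPoint_projRep] at h₂
  rw [← h₂, projPoint_eq_none_iff]
  exact Iff.of_eq (congrArg (fun v : K × K => v.2 = 0) (aeval_iterPair d g h m x))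

/-- The polynomial whose roots are the finite preimages of `b` under the `m`-th iterate. -/
noncomputable def fiberPoly (d : ℕ) (g h : F[X]) (m : ℕ) (b : K) : K[X] :=
  (iterPair d g h m).1.map (algebraMap F K) - C b * (iterPair d g h m).2.map (algebraMap F K)

theorem iterate_projMap_of_isRoot_fiberPoly (hgh : IsCoprime g h)
    (hd : max g.natDegree h.natDegree = d) {m : ℕ} {b x : K}
    (hx : (fiberPoly d g h m b).eval x = 0) : (projMap d g h)^[m] (some x) = some b := by
  obtain ⟨h₁, h₂⟩ := iterate_homMap hgh hd m (projRep_ne_zero (some x))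
  have e := aeval_iterPair d g h m x
  rw [projPoint_projRep] at h₂
  change Prod.map (aeval x) (aeval x) (iterPair d g h m) = (homMap d g h)^[m] (projRep (some x)) at e
  rw [← h₂]
  rw [← e] at h₁ ⊢
  simp only [fiberPoly, eval_sub, eval_mul, eval_C, eval_map_algebraMap, sub_eq_zero] at hx
  have hne : aeval x (iterPair d g h m).2 ≠ 0 := by
    intro h0
    rw [h0, mul_zero] at hx
    exact h₁ (by simp [Prod.map, hx, h0])
  simp [projPoint, Prod.map, hne, hx]

theorem natDegree_fiberPoly (hgh : IsCoprime g h)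
    (hd : max g.natDegree h.natDegree = d) {m : ℕ} {b : K}
    (hb : (projMap d g h)^[m] none ≠ some b) : (fiberPoly d g h m b).natDegree = d ^ m := by
  obtain ⟨h₁, h₂⟩ := natDegree_iterPair_le d g h m
  refine natDegree_eq_of_le_of_coeff_ne_zero ?_ ?_
  · refine (natDegree_sub_le _ _).trans (max_le ?_ ?_)
    · rwa [natDegree_map]
    · refine (natDegree_C_mul_le _ _).trans ?_
      rwa [natDegree_map]
  · intro h0
    apply hb
    obtain ⟨n₁, n₂⟩ := iterate_homMap (K := K) hgh hd m (projRep_ne_zero none)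
    have e := map_iterate_homMap (Algebra.ofId F K) d g h m (1, 0)
    rw [← coeff_iterPair] at e
    have e' : Prod.map (Algebra.ofId F K) (Algebra.ofId F K) ((1, 0) : F × F) = projRep none := by
      simp [projRep]
    rw [e'] at e
    rw [projPoint_projRep] at n₂
    rw [← n₂]
    rw [← e] at n₁ ⊢
    simp only [fiberPoly, coeff_sub, coeff_C_mul, coeff_map, sub_eq_zero] at h0
    simp only [Prod.map, Algebra.ofId_apply] at n₁ ⊢
    have hne : algebraMap F K ((iterPair d g h m).2.coeff (d ^ m)) ≠ 0 := by
      intro h00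
      rw [h00, mul_zero] at h0
      exact n₁ (by rw [h0, h00]; rfl)
    simp only [projPoint, hne, if_false, h0]
    rw [mul_div_cancel_right₀ _ hne]

theorem iterPair_ne_zero (hgh : IsCoprime g h)
    (hd : max g.natDegree h.natDegree = d) (hd0 : d ≠ 0) (m : ℕ) :
    (iterPair d g h m).1 ≠ 0 ∧ (iterPair d g h m).2 ≠ 0 := by
  let K := AlgebraicClosure F
  have hfin : ({some 0, (projMap d g h)^[m] none} : Set (Option K)).Finite := by simp
  obtain ⟨b, hb⟩ := (hfin.preimage (Option.some_injective K).injOn).infinite_compl.nonempty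
  simp only [Set.mem_compl_iff, Set.mem_preimage, Set.mem_insert_iff, Set.mem_singleton_iff,
    not_or] at hb
  have hdeg := natDegree_fiberPoly hgh hd (Ne.symm hb.2)
  obtain ⟨x, hx⟩ := IsAlgClosed.exists_root (fiberPoly d g h m b) (by
    refine degree_ne_of_natDegree_ne (n := 0) ?_
    rw [hdeg]
    exact pow_ne_zero _ hd0)
  have hx' := iterate_projMap_of_isRoot_fiberPoly hgh hd hx
  constructor
  · intro h0
    have := (aeval_iterPair_fst_eq_zero_iff hgh hd m x).1 (by rw [h0, map_zero])
    exact hb.1 (hx'.symm.trans this)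
  · intro h0
    have := (aeval_iterPair_snd_eq_zero_iff hgh hd m x).1 (by rw [h0, map_zero])
    rw [hx'] at this
    simp at this

theorem fiberPoly_dvd_fst (hd : max g.natDegree h.natDegree = d) {b : K} (hb : aeval b g = 0)
    (m : ℕ) : fiberPoly d g h m b ∣ (iterPair d g h (m + 1)).1.map (algebraMap F K) := by
  rw [iterPair_succ]
  have := map_homEval (mapAlgHom (Algebra.ofId F K)) d g (iterPair d g h m).1 (iterPair d g h m).2
  change map (algebraMap F K) _ = _ at this
  change _ ∣ map _ (homEval d g _ _)
  rw [this]
  exact sub_dvd_homEval (hd ▸ le_max_left _ _) hb _ _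

theorem fiberPoly_dvd_snd (hd : max g.natDegree h.natDegree = d) {b : K} (hb : aeval b h = 0)
    (m : ℕ) : fiberPoly d g h m b ∣ (iterPair d g h (m + 1)).2.map (algebraMap F K) := by
  rw [iterPair_succ]
  have := map_homEval (mapAlgHom (Algebra.ofId F K)) d h (iterPair d g h m).1 (iterPair d g h m).2
  change map (algebraMap F K) _ = _ at this
  change _ ∣ map _ (homEval d h _ _)
  rw [this]
  exact sub_dvd_homEval (hd ▸ le_max_right _ _) hb _ _

theorem exists_good_point [IsAlgClosed K] (hgh : IsCoprime g h)
    (hd : max g.natDegree h.natDegree = d)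
    (hdeg : (1 ≤ h.natDegree ∧ h.natDegree < g.natDegree) ∨
      (1 ≤ g.natDegree ∧ g.natDegree < h.natDegree)) :
    ∃ b : K, (aeval b g = 0 ∨ aeval b h = 0) ∧
      (∀ i, (projMap d g h)^[i] (some 0) ≠ some b) ∧ ∀ i, (projMap d g h)^[i] none ≠ some b := by
  have hg : g.natDegree ≤ d := hd ▸ le_max_left _ _
  have hh : h.natDegree ≤ d := hd ▸ le_max_right _ _
  have hsome : ∀ a : K, projMap d g h (some a) = projPoint (aeval a g, aeval a h) := by
    intro a
    simp [projMap, homMap, projRep, homEval_one_right hg, homEval_one_right hh]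
  have hcop : ∀ a : K, ((aeval a g, aeval a h) : K × K) ≠ 0 := by
    intro a
    rw [ne_eq, Prod.mk_eq_zero, not_and_or]
    exact aeval_ne_zero_of_isCoprime hgh a
  have hnone : projMap d g h (none : Option K) = none ∨ projMap d g h (none : Option K) = some 0 := by
    have hne := homMap_ne_zero (K := K) hgh hd (projRep_ne_zero none)
    rcases hdeg with h' | h'
    · left
      rw [projMap, projPoint_eq_none_iff]
      simp only [homMap, projRep, homEval_one_zero]
      rw [coeff_eq_zero_of_natDegree_lt (by omega), map_zero]
    · right
      rw [projMap, projPoint_eq_zero_iff hne]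
      simp only [homMap, projRep, homEval_one_zero]
      rw [coeff_eq_zero_of_natDegree_lt (by omega), map_zero]
  obtain ⟨b₁, hb₁⟩ := IsAlgClosed.exists_aeval_eq_zero K g
    (degree_ne_of_natDegree_ne (n := 0) (by rcases hdeg with h' | h' <;> omega))
  obtain ⟨b₂, hb₂⟩ := IsAlgClosed.exists_aeval_eq_zero K h
    (degree_ne_of_natDegree_ne (n := 0) (by rcases hdeg with h' | h' <;> omega))
  obtain ⟨b, h₁, h₂, h₃⟩ := exists_preimage_avoiding_orbits (projMap d g h) (z := some 0)
    (w := none) (b₁ := some b₁) (b₂ := some b₂) (by simp) hnone (by simp)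
    (by rw [hsome, projPoint_eq_zero_iff (hcop _)]; exact hb₁) (by simp)
    (by rw [hsome, projPoint_eq_none_iff]; exact hb₂)
  cases b with
  | none => exact absurd rfl (h₃ 0)
  | some b =>
    refine ⟨b, ?_, h₂, h₃⟩
    rwa [hsome, projPoint_eq_zero_iff (hcop _), projPoint_eq_none_iff] at h₁

end ProjectiveLine

section Products

/-- The polynomial `∏ i ∈ [1, n], A i ^ (k i)⁺ * B i ^ (k i)⁻`. -/
noncomputable def signedProd {R : Type*} [CommRing R] (A B : ℕ → R) (k : ℕ → ℤ) (n : ℕ) : R :=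
  ∏ i ∈ Finset.Icc 1 n, (A i ^ (k i).toNat * B i ^ (-k i).toNat)

theorem signedProd_swap {R : Type*} [CommRing R] (A B : ℕ → R) (k : ℕ → ℤ) (n : ℕ) :
    signedProd B A (-k) n = signedProd A B k n := by
  simp [signedProd, mul_comm]

theorem map_signedProd {R S : Type*} [CommRing R] [CommRing S] (σ : R →+* S) (A B : ℕ → R)
    (k : ℕ → ℤ) (n : ℕ) : σ (signedProd A B k n) = signedProd (σ ∘ A) (σ ∘ B) k n := by
  simp [signedProd]

theorem prod_div_zpow {L : Type*} [Field L] (A B : ℕ → L) (k : ℕ → ℤ) (n : ℕ) :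
    ∏ i ∈ Finset.Icc 1 n, (A i / B i) ^ k i = signedProd A B k n / signedProd A B (-k) n := by
  rw [signedProd, signedProd, ← Finset.prod_div_distrib]
  refine Finset.prod_congr rfl fun i _ => ?_
  rcases le_total 0 (k i) with hk | hk
  · obtain ⟨m, hm⟩ := Int.eq_ofNat_of_zero_le hk
    simp [hm, div_pow]
  · obtain ⟨m, hm⟩ := Int.eq_ofNat_of_zero_le (neg_nonneg.2 hk)
    have hm' : k i = -(m : ℤ) := by omega
    simp [hm', div_pow]

theorem dvd_signedProd_and_isCoprime {K : Type*} [Field K] [IsAlgClosed K] {A B : ℕ → K[X]}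
    {k : ℕ → ℤ} {n : ℕ} (hn : 1 ≤ n) (hk : 0 < k n) {Q : K[X]} (hQ : Q ∣ A n)
    (hcop : ∀ x, Q.eval x = 0 → (B n).eval x ≠ 0 ∧
      ∀ i, 1 ≤ i → i < n → (A i).eval x ≠ 0 ∧ (B i).eval x ≠ 0) :
    Q ∣ signedProd A B k n ∧ IsCoprime Q (signedProd A B (-k) n) := by
  constructor
  · refine dvd_trans ?_ (Finset.dvd_prod_of_mem _ (Finset.mem_Icc.2 ⟨hn, le_rfl⟩))
    exact (hQ.trans (dvd_pow_self _ (by omega))).mul_right _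
  · refine (isCoprime_iff_aeval_ne_zero_of_isAlgClosed K K _ _).2 fun x => ?_
    simp only [coe_aeval_eq_eval]
    by_contra! h
    obtain ⟨h₁, h₂⟩ := hcop x h.1
    refine absurd h.2 ?_
    rw [signedProd, eval_prod]
    refine Finset.prod_ne_zero_iff.2 ?_
    intro i hi
    obtain ⟨hi₁, hi₂⟩ := Finset.mem_Icc.1 hi
    rw [eval_mul, eval_pow, eval_pow]
    rcases hi₂.lt_or_eq with hlt | rfl
    · exact mul_ne_zero (pow_ne_zero _ (h₂ i hi₁ hlt).1) (pow_ne_zero _ (h₂ i hi₁ hlt).2)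
    · rw [Pi.neg_apply, Int.toNat_of_nonpos (by omega), pow_zero, one_mul]
      exact pow_ne_zero _ h₁

end Products

theorem natDegree_le_rdeg {F K : Type*} [Field F] [Field K] [Algebra F K] {r : RatFunc F}
    {U V : F[X]} (hr0 : r ≠ 0) (hV : V ≠ 0)
    (hr : r = algebraMap F[X] (RatFunc F) U / algebraMap F[X] (RatFunc F) V) {Q : K[X]}
    (hQ : (Q ∣ U.map (algebraMap F K) ∧ IsCoprime Q (V.map (algebraMap F K))) ∨
      (Q ∣ V.map (algebraMap F K) ∧ IsCoprime Q (U.map (algebraMap F K)))) :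
    Q.natDegree ≤ rdeg r := by
  have e := congrArg (Polynomial.map (algebraMap F K)) ((RatFunc.num_mul_eq_mul_denom_iff hV).2 hr)
  rw [Polynomial.map_mul, Polynomial.map_mul] at e
  have hmap : ∀ {p : F[X]}, p ≠ 0 → Q ∣ p.map (algebraMap F K) → Q.natDegree ≤ p.natDegree := by
    intro p hp h
    rw [← natDegree_map (algebraMap F K)]
    exact natDegree_le_of_dvd h ((Polynomial.map_ne_zero_iff (algebraMap F K).injective).2 hp)
  rcases hQ with ⟨h₁, h₂⟩ | ⟨h₁, h₂⟩
  · refine le_max_of_le_left (hmap (RatFunc.num_ne_zero hr0) (h₂.dvd_of_dvd_mul_right ?_))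
    rw [e]
    exact h₁.mul_right _
  · refine le_max_of_le_right (hmap r.denom_ne_zero (h₂.dvd_of_dvd_mul_left ?_))
    rw [← e]
    exact h₁.mul_left _

theorem riter_eq_div {F : Type*} [Field F] (f : RatFunc F) {d : ℕ} (hd : rdeg f = d) (hd0 : d ≠ 0)
    (m : ℕ) :
    riter f m = algebraMap F[X] (RatFunc F) (iterPair d f.num f.denom m).1 /
      algebraMap F[X] (RatFunc F) (iterPair d f.num f.denom m).2 := by
  induction m with
  | zero => simp [riter, iterPair]
  | succ m ih =>
    have hne : algebraMap F[X] (RatFunc F) (iterPair d f.num f.denom m).2 ≠ 0 :=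
      RatFunc.algebraMap_ne_zero (iterPair_ne_zero f.isCoprime_num_denom hd hd0 m).2
    have hmap := fun p => map_homEval (IsScalarTower.toAlgHom F F[X] (RatFunc F)) d p
      (iterPair d f.num f.denom m).1 (iterPair d f.num f.denom m).2
    simp only [IsScalarTower.coe_toAlgHom'] at hmap
    rw [riter, rcomp, RatFunc.eval, ih, iterPair_succ, homMap, hmap, hmap,
      homEval_eq_mul_aeval_div (hd ▸ le_max_left _ _) _ hne,
      homEval_eq_mul_aeval_div (hd ▸ le_max_right _ _) _ hne,
      mul_div_mul_left _ _ (pow_ne_zero _ hne)]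
    rfl

theorem stmt9 {F : Type*} [Field F] (f : RatFunc F) (d : ℕ) (hd : rdeg f = d) (hd2 : 2 ≤ d)
    (hmon : ¬ ∃ (a : F) (m : ℤ), f = RatFunc.C a * RatFunc.X ^ m)
    (hbin : ¬ ∃ (a b : F) (ℓ : ℕ),
        f = algebraMap (Polynomial F) (RatFunc F)
              (Polynomial.C a * Polynomial.X ^ (ringChar F ^ ℓ) + Polynomial.C b))
    (hconj : ¬ ∃ ψ : RatFunc F, rdeg ψ = 1 ∧ rcomp ψ f = rcomp (RatFunc.X ^ d)⁻¹ ψ)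
    (hdeg : (1 ≤ f.denom.natDegree ∧ f.denom.natDegree < f.num.natDegree) ∨
            (1 ≤ f.num.natDegree ∧ f.num.natDegree < f.denom.natDegree))
    (n : ℕ) (hn : 1 ≤ n) (k : ℕ → ℤ) (hk : k n ≠ 0) :
    d ^ (n - 1) ≤ rdeg (∏ i ∈ Finset.Icc 1 n, (riter f i) ^ (k i)) := by
  classical
  let K := AlgebraicClosure F
  have hd0 : d ≠ 0 := by omega
  have hgh := f.isCoprime_num_denom
  obtain ⟨m, rfl⟩ := Nat.exists_eq_add_of_le' hn
  rw [Nat.add_sub_cancel]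
  obtain ⟨b, hb, hb₀, hb₁⟩ := exists_good_point (K := K) hgh hd hdeg
  set G : ℕ → F[X] := fun i => (iterPair d f.num f.denom i).1
  set H : ℕ → F[X] := fun i => (iterPair d f.num f.denom i).2
  have hne : ∀ k, signedProd G H k (m + 1) ≠ 0 := fun k => Finset.prod_ne_zero_iff.2 fun i _ =>
    mul_ne_zero (pow_ne_zero _ (iterPair_ne_zero hgh hd hd0 i).1)
      (pow_ne_zero _ (iterPair_ne_zero hgh hd hd0 i).2)
  have hr : ∏ i ∈ Finset.Icc 1 (m + 1), riter f i ^ k i =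
      algebraMap F[X] (RatFunc F) (signedProd G H k (m + 1)) /
        algebraMap F[X] (RatFunc F) (signedProd G H (-k) (m + 1)) := by
    rw [map_signedProd, map_signedProd, ← prod_div_zpow]
    simp only [riter_eq_div f hd hd0]
    rfl
  have hr0 : ∏ i ∈ Finset.Icc 1 (m + 1), riter f i ^ k i ≠ 0 := by
    rw [hr]
    exact div_ne_zero (RatFunc.algebraMap_ne_zero (hne _)) (RatFunc.algebraMap_ne_zero (hne _))
  rw [← natDegree_fiberPoly (m := m) hgh hd (hb₁ m)]
  refine natDegree_le_rdeg hr0 (hne _) hr ?_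
  have hmap : ∀ k, (signedProd G H k (m + 1)).map (algebraMap F K) =
      signedProd (mapRingHom (algebraMap F K) ∘ G) (mapRingHom (algebraMap F K) ∘ H) k (m + 1) :=
    fun k => map_signedProd (mapRingHom (algebraMap F K)) G H k (m + 1)
  rw [hmap, hmap]
  have horbit : ∀ x, (fiberPoly d f.num f.denom m b).eval x = 0 → ∀ i ≤ m,
      aeval x (G i) ≠ 0 ∧ aeval x (H i) ≠ 0 := by
    intro x hx i hi
    have hx' := iterate_projMap_of_isRoot_fiberPoly hgh hd hx
    rw [← Nat.sub_add_cancel hi, Function.iterate_add_apply] at hx'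
    constructor
    · intro h0
      rw [(aeval_iterPair_fst_eq_zero_iff hgh hd i x).1 h0] at hx'
      exact hb₀ _ hx'
    · intro h0
      rw [(aeval_iterPair_snd_eq_zero_iff hgh hd i x).1 h0] at hx'
      exact hb₁ _ hx'
  have hlast : ∀ x : K, aeval x (G (m + 1)) ≠ 0 ∨ aeval x (H (m + 1)) ≠ 0 := by
    intro x
    by_contra! h
    have := (aeval_iterPair_fst_eq_zero_iff hgh hd (m + 1) x).1 h.1
    rw [(aeval_iterPair_snd_eq_zero_iff hgh hd (m + 1) x).1 h.2] at this
    simp at this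
  have hcomp : ∀ (A : ℕ → F[X]) (i : ℕ) (x : K),
      ((mapRingHom (algebraMap F K) ∘ A) i).eval x = aeval x (A i) := fun A i x => by
    simp [eval_map_algebraMap]
  have hzero : ∀ (A : F[X]) (x : K), fiberPoly d f.num f.denom m b ∣ A.map (algebraMap F K) →
      (fiberPoly d f.num f.denom m b).eval x = 0 → aeval x A = 0 := by
    intro A x hA hx
    rw [← eval_map_algebraMap]
    exact eval_eq_zero_of_dvd_of_eval_eq_zero hA hx
  rcases hb with hb | hb
  · have hdvd := fiberPoly_dvd_fst hd hb m
    have key := fun (k : ℕ → ℤ) (hk : 0 < k (m + 1)) => dvd_signedProd_and_isCoprime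
      (K := K) (k := k) (A := mapRingHom (algebraMap F K) ∘ G) (B := mapRingHom (algebraMap F K) ∘ H)
      hn hk hdvd fun x hx => by
        simp only [hcomp]
        exact ⟨(hlast x).resolve_left (not_not.2 (hzero _ x hdvd hx)),
          fun i _ hi => horbit x hx i (by omega)⟩
    rcases lt_or_gt_of_ne hk with hk | hk
    · have := key (-k) (by simpa using hk)
      rw [neg_neg] at this
      exact Or.inr this
    · exact Or.inl (key k hk)
  · have hdvd := fiberPoly_dvd_snd hd hb m
    have key := fun (k : ℕ → ℤ) (hk : 0 < k (m + 1)) => dvd_signedProd_and_isCoprime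
      (K := K) (k := k) (A := mapRingHom (algebraMap F K) ∘ H) (B := mapRingHom (algebraMap F K) ∘ G)
      hn hk hdvd fun x hx => by
        simp only [hcomp]
        exact ⟨(hlast x).resolve_right (not_not.2 (hzero _ x hdvd hx)),
          fun i _ hi => (horbit x hx i (by omega)).symm⟩
    rcases lt_or_gt_of_ne hk with hk | hk
    · have := key (-k) (by simpa using hk)
      rw [neg_neg, signedProd_swap] at this
      refine Or.inl ⟨this.1, ?_⟩
      rw [← signedProd_swap, neg_neg]
      exact this.2
    · have := key k hk
      rw [signedProd_swap] at this
      refine Or.inr ⟨?_, this.2⟩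
      rw [← signedProd_swap, neg_neg]
      exact this.1
end

section
/- Let 𝔽 be a field of characteristic 0 and f = g/h ∈ 𝔽(X) of degree d ≥ 2, not a monomial and not linearly conjugate to 1/X^d. Then the iterates f^(1), …, f^(n) are multiplicatively independent in 𝔽(X): if (f^(1))^{k_1}⋯(f^(n))^{k_n} = 1 for integers k_i, then k_1 = ⋯ = k_n = 0. -/
open Polynomial

section Composition

variable {F : Type*} [Field F]

theorem rcomp_algHom_X (φ : RatFunc F →ₐ[F] RatFunc F) (u : RatFunc F) :
    rcomp u (φ RatFunc.X) = φ u := by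
  have key (p : F[X]) : p.eval₂ (algebraMap F (RatFunc F)) (φ RatFunc.X) =
      φ (algebraMap F[X] (RatFunc F) p) := by
    rw [← aeval_def, aeval_algHom_apply, RatFunc.aeval_X_left_eq_algebraMap]
  rw [rcomp, RatFunc.eval, key, key, ← map_div₀, RatFunc.num_div_denom]

theorem RatFunc.algHom_ext_X {φ ψ : RatFunc F →ₐ[F] RatFunc F}
    (h : φ RatFunc.X = ψ RatFunc.X) : φ = ψ := by
  ext u
  rw [← rcomp_algHom_X φ, ← rcomp_algHom_X ψ, h]

theorem riter_eq_pow_apply_X {f : RatFunc F} {φ : RatFunc F →ₐ[F] RatFunc F}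
    (hφ : φ RatFunc.X = f) (k : ℕ) : riter f k = (φ ^ k) RatFunc.X := by
  induction k with
  | zero => rfl
  | succ k ih => rw [riter, ih, rcomp_algHom_X, pow_succ, AlgHom.mul_apply, hφ]

/-- A non-constant rational function can be substituted for the variable. -/
theorem RatFunc.exists_algHom_apply_X {f : RatFunc F} (hf : ¬ ∃ c, f = RatFunc.C c) :
    ∃ φ : RatFunc F →ₐ[F] RatFunc F, φ RatFunc.X = f := by
  have hf' := f.transcendental_of_ne_C hf
  refine ⟨(IntermediateField.val _).comp (RatFunc.algEquivOfTranscendental f hf').toAlgHom, ?_⟩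
  simp [RatFunc.algEquivOfTranscendental_X]

theorem RatFunc.algHom_apply_algebraMap (φ : RatFunc F →ₐ[F] RatFunc F) (p : F[X]) :
    φ (algebraMap F[X] (RatFunc F) p) = aeval (φ RatFunc.X) p := by
  rw [aeval_algHom_apply, RatFunc.aeval_X_left_eq_algebraMap]

theorem not_exists_eq_C_of_one_le_rdeg {f : RatFunc F} (hf : 1 ≤ rdeg f) :
    ¬ ∃ c, f = RatFunc.C c := by
  rintro ⟨c, rfl⟩
  simp [rdeg] at hf

end Composition

section LinearFactors

variable {K : Type*} [Field K] {g h : K[X]}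

theorem isCoprime_sub_C_mul_self (hgh : IsCoprime g h) (α : K) : IsCoprime (g - C α * h) h := by
  obtain ⟨u, v, huv⟩ := hgh
  exact ⟨u, v + u * C α, by linear_combination huv⟩

theorem isCoprime_sub_C_mul_sub_C_mul (hgh : IsCoprime g h) {α β : K} (hαβ : α ≠ β) :
    IsCoprime (g - C α * h) (g - C β * h) := by
  obtain ⟨u, v, huv⟩ := isCoprime_sub_C_mul_self hgh α
  have hc : C (α - β)⁻¹ * (C α - C β) = 1 := by
    rw [← C_sub, ← C_mul, inv_mul_cancel₀ (sub_ne_zero.2 hαβ), C_1]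
  exact ⟨u - v * C (α - β)⁻¹, v * C (α - β)⁻¹, by linear_combination huv + v * h * hc⟩

theorem isCoprime_multiset_prod_right {R : Type*} [CommRing R] {ι : Type*} {x : R} {w : ι → R}
    {s : Multiset ι} (hs : ∀ i ∈ s, IsCoprime x (w i)) : IsCoprime x (s.map w).prod := by
  induction s using Multiset.induction_on with
  | empty => simpa using isCoprime_one_right
  | cons a s ih =>
    rw [Multiset.map_cons, Multiset.prod_cons]
    exact (hs a (by simp)).mul_right (ih fun i hi => hs i (by simp [hi]))

theorem exists_eq_C_mul_X_pow_of_dvd {p : K[X]} {n : ℕ} (hp : p ∣ X ^ n) :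
    ∃ c : K, c ≠ 0 ∧ ∃ i, p = C c * X ^ i := by
  obtain ⟨i, -, hi⟩ := (dvd_prime_pow prime_X n).1 hp
  obtain ⟨u, hu⟩ := hi.symm
  obtain ⟨c, hc, hcu⟩ := Polynomial.isUnit_iff.1 u.isUnit
  exact ⟨c, hc.ne_zero, i, by rw [← hu, ← hcu, mul_comm]⟩

theorem exists_eq_C_of_isUnit {p : K[X]} (hp : IsUnit p) : ∃ c : K, c ≠ 0 ∧ p = C c := by
  obtain ⟨c, hc, hcu⟩ := Polynomial.isUnit_iff.1 hp
  exact ⟨c, hc.ne_zero, hcu.symm⟩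

/-- If a product of integer powers of linear forms in coprime `g`, `h` is a nontrivial power of
`X`, then some two independent linear forms in `g`, `h` are a monomial and a constant. -/
theorem exists_linear_forms_of_prod_eq (hgh : IsCoprime g h) {s t : Multiset K}
    (hst : Disjoint s t) {c : K} (hc : c ≠ 0) {k : ℕ} (hk : k ≠ 0)
    (heq : (s.map fun α => g - C α * h).prod * h ^ t.card =
      C c * X ^ k * (t.map fun α => g - C α * h).prod * h ^ s.card) :
    ∃ a b a' b' e e' : K, ∃ r : ℕ, a * b' - a' * b ≠ 0 ∧ e ≠ 0 ∧ e' ≠ 0 ∧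
      C a * g + C b * h = C e * X ^ r ∧ C a' * g + C b' * h = C e' := by
  have hcu : IsUnit (C c : K[X]) := isUnit_C.2 hc.isUnit
  have hs_dvd {α : K} (hα : α ∈ s) : ∃ e : K, e ≠ 0 ∧ ∃ i, g - C α * h = C e * X ^ i := by
    apply exists_eq_C_mul_X_pow_of_dvd (n := k)
    have h1 : g - C α * h ∣ C c * X ^ k * (t.map fun α => g - C α * h).prod * h ^ s.card := by
      rw [← heq]
      exact (Multiset.dvd_prod (Multiset.mem_map_of_mem _ hα)).mul_right _
    have h2 := (isCoprime_sub_C_mul_self hgh α).pow_right (n := s.card) |>.dvd_of_dvd_mul_right h1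
    refine (hcu.dvd_mul_left).1 ((isCoprime_multiset_prod_right fun β hβ =>
      isCoprime_sub_C_mul_sub_C_mul hgh ?_).dvd_of_dvd_mul_right h2)
    rintro rfl
    exact Multiset.disjoint_left.1 hst hα hβ
  have ht_dvd {β : K} (hβ : β ∈ t) : ∃ e : K, e ≠ 0 ∧ g - C β * h = C e := by
    apply exists_eq_C_of_isUnit
    have h1 : g - C β * h ∣ (s.map fun α => g - C α * h).prod * h ^ t.card := by
      rw [heq]
      exact ((Multiset.dvd_prod (Multiset.mem_map_of_mem _ hβ)).mul_left _).mul_right _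
    refine IsCoprime.isUnit_of_dvd' (IsCoprime.mul_right ?_ ?_) dvd_rfl h1
    · refine isCoprime_multiset_prod_right fun α hα => isCoprime_sub_C_mul_sub_C_mul hgh ?_
      rintro rfl
      exact Multiset.disjoint_left.1 hst hα hβ
    · exact (isCoprime_sub_C_mul_self hgh β).pow_right
  have hcop (s : Multiset K) : IsCoprime h (s.map fun α => g - C α * h).prod :=
    isCoprime_multiset_prod_right fun α _ => (isCoprime_sub_C_mul_self hgh α).symm
  rcases s.empty_or_exists_mem with rfl | ⟨α, hα⟩ <;>
    rcases t.empty_or_exists_mem with rfl | ⟨β, hβ⟩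
  · have := congrArg (eval 0) heq
    simp [hk] at this
  · obtain ⟨e', he', hβe⟩ := ht_dvd hβ
    have h1 : h ∣ X ^ k := by
      refine (hcu.dvd_mul_left).1 ((hcop t).dvd_of_dvd_mul_right ?_)
      simp only [Multiset.map_zero, Multiset.prod_zero, one_mul, Multiset.card_zero, pow_zero,
        mul_one] at heq
      rw [← heq]
      exact dvd_pow_self h (Multiset.card_pos_iff_exists_mem.2 ⟨β, hβ⟩).ne'
    obtain ⟨e, he, r, hr⟩ := exists_eq_C_mul_X_pow_of_dvd h1
    exact ⟨0, 1, 1, -β, e, e', r, by simp, he, he', by simpa using hr,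
      by rw [← hβe]; simp [sub_eq_add_neg]⟩
  · obtain ⟨e, he, r, hr⟩ := hs_dvd hα
    have h1 : h ∣ (s.map fun α => g - C α * h).prod := by
      simp only [Multiset.map_zero, Multiset.prod_zero, Multiset.card_zero, pow_zero,
        mul_one] at heq
      rw [heq]
      exact (dvd_pow_self h (Multiset.card_pos_iff_exists_mem.2 ⟨α, hα⟩).ne').mul_left _
    obtain ⟨e', he', hh⟩ := exists_eq_C_of_isUnit ((hcop s).isUnit_of_dvd' dvd_rfl h1)
    exact ⟨1, -α, 0, 1, e, e', r, by simp, he, he', by rw [← hr]; simp [sub_eq_add_neg],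
      by simpa using hh⟩
  · obtain ⟨e, he, r, hr⟩ := hs_dvd hα
    obtain ⟨e', he', hβe⟩ := ht_dvd hβ
    refine ⟨1, -α, 1, -β, e, e', r, ?_, he, he', by rw [← hr]; simp [sub_eq_add_neg],
      by rw [← hβe]; simp [sub_eq_add_neg]⟩
    have hαβ : α ≠ β := fun hαβ => Multiset.disjoint_left.1 hst hα (hαβ ▸ hβ)
    intro h0
    exact hαβ (by linear_combination h0)

end LinearFactors

section AlgClosed

variable {K : Type*} [Field K]

theorem algHom_apply_mul_pow_of_splits {g h : K[X]} (hh : h ≠ 0)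
    {φ : RatFunc K →ₐ[K] RatFunc K}
    (hφ : φ RatFunc.X = algebraMap K[X] (RatFunc K) g / algebraMap K[X] (RatFunc K) h)
    {p : K[X]} (hp : p.Splits) :
    φ (algebraMap K[X] (RatFunc K) p) * algebraMap K[X] (RatFunc K) h ^ p.roots.card =
      algebraMap K[X] (RatFunc K)
        (C p.leadingCoeff * (p.roots.map fun α => g - C α * h).prod) := by
  have hh' : algebraMap K[X] (RatFunc K) h ≠ 0 := by simpa using hh
  have key (s : Multiset K) : φ (algebraMap K[X] (RatFunc K) (s.map fun α => X - C α).prod) *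
      algebraMap K[X] (RatFunc K) h ^ s.card =
        algebraMap K[X] (RatFunc K) (s.map fun α => g - C α * h).prod := by
    induction s using Multiset.induction_on with
    | empty => simp
    | cons a s ih =>
      simp only [Multiset.map_cons, Multiset.prod_cons, map_mul, Multiset.card_cons, ← ih]
      rw [RatFunc.algHom_apply_algebraMap φ (X - C a), hφ]
      simp only [map_sub, aeval_X, aeval_C, map_mul, pow_succ, RatFunc.algebraMap_C,
        RatFunc.algebraMap_eq_C]
      field_simp
  nth_rw 1 [hp.eq_prod_roots]
  rw [map_mul, map_mul, map_mul, mul_assoc, key, RatFunc.algHom_apply_algebraMap φ (C _)]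
  simp

variable [IsAlgClosed K]

theorem exists_linear_forms_of_algHom_apply_eq_X_pow {g h : K[X]} (hgh : IsCoprime g h)
    (hh : h ≠ 0) {φ : RatFunc K →ₐ[K] RatFunc K}
    (hφ : φ RatFunc.X = algebraMap K[X] (RatFunc K) g / algebraMap K[X] (RatFunc K) h)
    {G : RatFunc K} {k : ℕ} (hk : k ≠ 0) (hG : φ G = RatFunc.X ^ k) :
    ∃ a b a' b' e e' : K, ∃ r : ℕ, a * b' - a' * b ≠ 0 ∧ e ≠ 0 ∧ e' ≠ 0 ∧
      C a * g + C b * h = C e * X ^ r ∧ C a' * g + C b' * h = C e' := by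
  have hG0 : G ≠ 0 := by
    rintro rfl
    rw [map_zero] at hG
    exact pow_ne_zero k RatFunc.X_ne_zero hG.symm
  have hn := RatFunc.num_ne_zero hG0
  have hd := G.denom_ne_zero
  have hPQ : φ (algebraMap K[X] (RatFunc K) G.num) =
      RatFunc.X ^ k * φ (algebraMap K[X] (RatFunc K) G.denom) := by
    rw [← hG, ← map_mul]
    congr 1
    exact (div_eq_iff (RatFunc.algebraMap_ne_zero hd)).1 G.num_div_denom
  have h1 := algHom_apply_mul_pow_of_splits hh hφ (IsAlgClosed.splits G.num)
  have h2 := algHom_apply_mul_pow_of_splits hh hφ (IsAlgClosed.splits G.denom)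
  set L : Multiset K → K[X] := fun s => (s.map fun α => g - C α * h).prod with hL
  have h3 : C G.num.leadingCoeff * L G.num.roots * h ^ G.denom.roots.card =
      X ^ k * (C G.denom.leadingCoeff * L G.denom.roots) * h ^ G.num.roots.card := by
    apply RatFunc.algebraMap_injective K
    rw [map_mul, map_mul _ (X ^ k * _), map_mul _ (X ^ k), ← h1, ← h2, hPQ]
    simp only [map_pow, RatFunc.algebraMap_X]
    ring
  have hln := leadingCoeff_ne_zero.2 hn
  have hld := leadingCoeff_ne_zero.2 hd
  refine exists_linear_forms_of_prod_eq hgh (s := G.num.roots) (t := G.denom.roots)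
    (c := G.num.leadingCoeff⁻¹ * G.denom.leadingCoeff) ?_ (mul_ne_zero (inv_ne_zero hln) hld) hk ?_
  · rw [Multiset.disjoint_left]
    intro α hα hα'
    obtain ⟨u, v, huv⟩ := G.isCoprime_num_denom
    have := congrArg (eval α) huv
    simp [(mem_roots'.1 hα).2.eq_zero, (mem_roots'.1 hα').2.eq_zero] at this
  · have hC : (C G.num.leadingCoeff⁻¹ : K[X]) * C G.num.leadingCoeff = 1 := by
      rw [← C_mul, inv_mul_cancel₀ hln, C_1]
    rw [C_mul]
    change L G.num.roots * _ = _ * L G.denom.roots * _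
    linear_combination C G.num.leadingCoeff⁻¹ * h3 - L G.num.roots * h ^ G.denom.roots.card * hC

variable [CharZero K]

theorem monomial_of_algHom_apply_eq_X_pow {g h : K[X]} (hgh : IsCoprime g h) (hh : h ≠ 0)
    (hdeg : 2 ≤ max g.natDegree h.natDegree) {φ : RatFunc K →ₐ[K] RatFunc K}
    (hφ : φ RatFunc.X = algebraMap K[X] (RatFunc K) g / algebraMap K[X] (RatFunc K) h)
    {H : RatFunc K} {k : ℕ} (hk : k ≠ 0) {m : ℤ}
    (hH : φ (RatFunc.X ^ m * φ H) = RatFunc.X ^ k) :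
    ∃ (x y : K) (i j : ℕ), g = C x * X ^ i ∧ h = C y * X ^ j := by
  obtain ⟨a, b, a', b', e, e', r, hdet, he, he', hA, hB⟩ :=
    exists_linear_forms_of_algHom_apply_eq_X_pow hgh hh hφ hk hH
  set D := a * b' - a' * b with hD
  have hCD : (C D⁻¹ : K[X]) * (C a * C b' - C a' * C b) = 1 := by
    rw [← C_mul, ← C_mul, ← C_sub, ← hD, ← C_mul, inv_mul_cancel₀ hdet, C_1]
  have hg : g = C (D⁻¹ * b' * e) * X ^ r + C (-(D⁻¹ * b * e')) := by
    simp only [C_mul, C_neg]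
    linear_combination C D⁻¹ * C b' * hA - C D⁻¹ * C b * hB - g * hCD
  have hh' : h = C (-(D⁻¹ * a' * e)) * X ^ r + C (D⁻¹ * a * e') := by
    simp only [C_mul, C_neg]
    linear_combination - C D⁻¹ * C a' * hA + C D⁻¹ * C a * hB - h * hCD
  have hr : 2 ≤ r := by
    have hle (x y : K) : (C x * X ^ r + C y).natDegree ≤ r := by compute_degree
    refine hdeg.trans (max_le ?_ ?_)
    · rw [hg]; exact hle _ _
    · rw [hh']; exact hle _ _
  have : NeZero r := ⟨by omega⟩
  obtain ⟨ζ, hζ⟩ := HasEnoughRootsOfUnity.exists_primitiveRoot K r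
  have hζ1 : ζ ≠ 1 := hζ.ne_one (by omega)
  have hζr : ζ ^ r = 1 := hζ.pow_eq_one
  have hζ0 : ζ ≠ 0 := hζ.ne_zero (by omega)
  obtain ⟨σ, hσ⟩ := RatFunc.exists_algHom_apply_X (f := RatFunc.C ζ * RatFunc.X) (by
    rintro ⟨c, hc⟩
    rw [← RatFunc.algebraMap_C, ← RatFunc.algebraMap_X, ← map_mul, ← RatFunc.algebraMap_C] at hc
    have := congrArg natDegree (RatFunc.algebraMap_injective K hc)
    simp [hζ0] at this)
  have hσp (p : K[X]) : σ (algebraMap K[X] (RatFunc K) p) =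
      algebraMap K[X] (RatFunc K) (p.comp (C ζ * X)) := by
    rw [RatFunc.algHom_apply_algebraMap, hσ, comp, ← RatFunc.algebraMap_C, ← RatFunc.algebraMap_X,
      ← map_mul, hom_eval₂]
    rfl
  have hfix (x y : K) : (C x * X ^ r + C y).comp (C ζ * X) = C x * X ^ r + C y := by
    simp [mul_pow, ← C_pow, hζr]
  have hσφ (u : RatFunc K) : σ (φ u) = φ u := by
    have : σ.comp φ = φ := by
      apply RatFunc.algHom_ext_X
      rw [AlgHom.comp_apply, hφ, map_div₀, hσp, hσp, hg, hh', hfix, hfix]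
    exact DFunLike.congr_fun this u
  set A : K[X] := C a * X + C b with hAdef
  set B : K[X] := C a' * X + C b' with hBdef
  have hB0 : B ≠ 0 := by
    intro h0
    have h1 := congrArg (coeff · 1) h0
    have h2 := congrArg (coeff · 0) h0
    simp [hBdef] at h1 h2
    exact hdet (by rw [hD, h1, h2]; ring)
  have hBζ0 : B.comp (C ζ * X) ≠ 0 := by
    intro h0
    have h1 := congrArg (coeff · 1) h0
    have h2 := congrArg (coeff · 0) h0
    simp [hBdef, hζ0] at h1 h2
    exact hdet (by rw [hD, h1, h2]; ring)
  set N : RatFunc K := algebraMap K[X] (RatFunc K) A / algebraMap K[X] (RatFunc K) B with hN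
  have hφN : φ N = RatFunc.C (e / e') * RatFunc.X ^ r := by
    have hh0 : algebraMap K[X] (RatFunc K) h ≠ 0 := RatFunc.algebraMap_ne_zero hh
    have hA' := congrArg (algebraMap K[X] (RatFunc K)) hA
    have hB' := congrArg (algebraMap K[X] (RatFunc K)) hB
    simp only [map_add, map_mul, map_pow, RatFunc.algebraMap_C, RatFunc.algebraMap_X] at hA' hB'
    have hφA : φ (algebraMap K[X] (RatFunc K) A) =
        RatFunc.C e * RatFunc.X ^ r / algebraMap K[X] (RatFunc K) h := by
      rw [← hA', RatFunc.algHom_apply_algebraMap, hφ]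
      simp only [hAdef, map_add, map_mul, aeval_X, aeval_C, RatFunc.algebraMap_eq_C]
      field_simp
    have hφB : φ (algebraMap K[X] (RatFunc K) B) =
        RatFunc.C e' / algebraMap K[X] (RatFunc K) h := by
      rw [← hB', RatFunc.algHom_apply_algebraMap, hφ]
      simp only [hBdef, map_add, map_mul, aeval_X, aeval_C, RatFunc.algebraMap_eq_C]
      field_simp
    have he'' : RatFunc.C e' ≠ 0 := by simpa using he'
    rw [hN, map_div₀, hφA, hφB, map_div₀]
    field_simp
  have hGN : RatFunc.C (e / e') ^ k * (RatFunc.X ^ m * φ H) ^ r = N ^ k := by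
    apply φ.toRingHom.injective
    change φ _ = φ _
    rw [map_mul, map_pow φ _ r, hH, map_pow, map_pow, hφN, ← RatFunc.algebraMap_eq_C,
      AlgHom.commutes]
    ring
  have hσN : σ N ^ k = N ^ k := by
    rw [← map_pow, ← hGN]
    simp only [map_mul, map_pow, hσφ, map_zpow₀, hσ]
    rw [← RatFunc.algebraMap_eq_C, AlgHom.commutes]
    have : (RatFunc.C ζ ^ m) ^ r = 1 := by
      rw [← zpow_natCast, ← zpow_mul, mul_comm, zpow_mul, zpow_natCast, ← map_pow, hζr, map_one,
        one_zpow]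
    simp only [RatFunc.algebraMap_eq_C, mul_zpow, mul_pow, this, one_mul]
  have hpoly : (A.comp (C ζ * X) * B) ^ k = (A * B.comp (C ζ * X)) ^ k := by
    apply RatFunc.algebraMap_injective K
    have hB1 : algebraMap K[X] (RatFunc K) B ≠ 0 := RatFunc.algebraMap_ne_zero hB0
    have hB2 : algebraMap K[X] (RatFunc K) (B.comp (C ζ * X)) ≠ 0 :=
      RatFunc.algebraMap_ne_zero hBζ0
    rw [hN, map_div₀, hσp, hσp, div_pow, div_pow, div_eq_div_iff (by positivity) (by positivity)]
      at hσN
    simpa only [map_pow, map_mul, mul_pow] using hσN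
  have heval (x : K) : (a * (ζ * x) + b) * (a' * x + b') = 0 ↔
      (a * x + b) * (a' * (ζ * x) + b') = 0 := by
    have := congrArg (eval x) hpoly
    simp [hAdef, hBdef] at this
    rw [← pow_eq_zero_iff hk, this, pow_eq_zero_iff hk]
  have hζ1' : 1 - ζ ≠ 0 := sub_ne_zero.2 hζ1.symm
  have hab : a = 0 ∨ b = 0 := by
    by_contra! hab
    obtain ⟨ha, hb⟩ := hab
    have h0 := (heval (-b / a)).2 (by field_simp; ring)
    have h1 : b * (1 - ζ) * D = 0 := by
      field_simp at h0
      rw [hD]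
      linear_combination h0
    exact mul_ne_zero (mul_ne_zero hb hζ1') hdet h1
  have hab' : a' = 0 ∨ b' = 0 := by
    by_contra! hab
    obtain ⟨ha, hb⟩ := hab
    have h0 := (heval (-b' / a')).1 (by field_simp; ring)
    have h1 : b' * (1 - ζ) * D = 0 := by
      field_simp at h0
      rw [hD]
      linear_combination -h0
    exact mul_ne_zero (mul_ne_zero hb hζ1') hdet h1
  rcases hab with ha | hb
  · have hb' : b' = 0 := hab'.resolve_left fun ha' => hdet (by rw [hD, ha, ha']; ring)
    exact ⟨-(D⁻¹ * b * e'), -(D⁻¹ * a' * e), 0, r, hg.trans (by rw [hb']; simp),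
      hh'.trans (by rw [ha]; simp)⟩
  · have ha' : a' = 0 := hab'.resolve_right fun hb' => hdet (by rw [hD, hb, hb']; ring)
    exact ⟨D⁻¹ * b' * e, D⁻¹ * a * e', r, 0, hg.trans (by rw [hb]; simp),
      hh'.trans (by rw [ha']; simp)⟩

end AlgClosed

section BaseChange

variable {F : Type*} [Field F]

theorem eq_C_mul_X_pow_of_map_eq {K : Type*} [Field K] (i : F →+* K) {p : F[X]} {c : K} {n : ℕ}
    (hp : p.map i = C c * X ^ n) : p = C (p.coeff n) * X ^ n := by
  ext j
  rw [coeff_C_mul_X_pow]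
  split_ifs with hj
  · rw [hj]
  · apply i.injective
    rw [← coeff_map, hp, coeff_C_mul_X_pow, if_neg hj, map_zero]

/-- The only multiplicative relation between `X` and a function of the form `(X ^ m * H ∘ f) ∘ f`
is trivial in `X`, unless `f` is a monomial. -/
theorem eq_zero_of_X_zpow_mul_eq_one [CharZero F] {f : RatFunc F} (hd : 2 ≤ rdeg f)
    (hmon : ¬ ∃ (a : F) (m : ℤ), f = RatFunc.C a * RatFunc.X ^ m)
    {φ : RatFunc F →ₐ[F] RatFunc F} (hφ : φ RatFunc.X = f) {l m : ℤ} {H : RatFunc F}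
    (hrel : RatFunc.X ^ l * φ (RatFunc.X ^ m * φ H) = 1) : l = 0 := by
  by_contra hl
  obtain ⟨k, m', H', hk, hH⟩ : ∃ (k : ℕ) (m' : ℤ) (H' : RatFunc F), k ≠ 0 ∧
      φ (RatFunc.X ^ m' * φ H') = RatFunc.X ^ k := by
    have hinv := eq_inv_of_mul_eq_one_right hrel
    refine ⟨l.natAbs, ?_⟩
    rcases l.natAbs_eq with hl' | hl'
    · refine ⟨-m, H⁻¹, Int.natAbs_ne_zero.2 hl, ?_⟩
      rw [map_inv₀, zpow_neg, ← mul_inv, map_inv₀, hinv, inv_inv]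
      nth_rw 1 [hl']
      rw [zpow_natCast]
    · refine ⟨m, H, Int.natAbs_ne_zero.2 hl, ?_⟩
      rw [hinv, ← zpow_neg]
      nth_rw 1 [hl']
      rw [neg_neg, zpow_natCast]
  let K := AlgebraicClosure F
  have : CharZero K := charZero_of_injective_algebraMap (algebraMap F K).injective
  let i := algebraMap F K
  have hi : Function.Injective (mapRingHom i) := map_injective i i.injective
  let ι : RatFunc F →+* RatFunc K :=
    RatFunc.mapRingHom (mapRingHom i) (nonZeroDivisors_le_comap_nonZeroDivisors_of_injective _ hi)
  have hι (p : F[X]) : ι (algebraMap F[X] (RatFunc F) p) =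
      algebraMap K[X] (RatFunc K) (p.map i) := by
    have := RatFunc.map_apply_div (mapRingHom i)
      (nonZeroDivisors_le_comap_nonZeroDivisors_of_injective _ hi) p 1
    simpa [ι, RatFunc.coe_mapRingHom_eq_coe_map] using this
  have hιf : ι f = algebraMap K[X] (RatFunc K) (f.num.map i) /
      algebraMap K[X] (RatFunc K) (f.denom.map i) := by
    rw [← hι, ← hι, ← map_div₀, f.num_div_denom]
  have hcop : IsCoprime (f.num.map i) (f.denom.map i) := f.isCoprime_num_denom.map (mapRingHom i)
  have hdenom : f.denom.map i ≠ 0 := (Polynomial.map_ne_zero_iff i.injective).2 f.denom_ne_zero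
  have hdeg : 2 ≤ max (f.num.map i).natDegree (f.denom.map i).natDegree := by
    simpa only [natDegree_map, rdeg] using hd
  obtain ⟨ψ, hψ⟩ := RatFunc.exists_algHom_apply_X (f := ι f) (by
    rintro ⟨c, hc⟩
    have hc' : f.num.map i = C c * f.denom.map i := by
      apply RatFunc.algebraMap_injective K
      rw [hιf, div_eq_iff (RatFunc.algebraMap_ne_zero hdenom)] at hc
      rw [hc, map_mul, RatFunc.algebraMap_C]
    have hu : IsUnit (f.denom.map i) := hcop.isUnit_of_dvd' ⟨C c, by rw [hc', mul_comm]⟩ dvd_rfl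
    have h0 := natDegree_eq_zero_of_isUnit hu
    have h1 : (f.num.map i).natDegree ≤ 0 := by
      rw [hc', ← h0]
      exact natDegree_C_mul_le _ _
    omega)
  have hcomm (u : RatFunc F) : ψ (ι u) = ι (φ u) := by
    have key (p : F[X]) : ψ (ι (algebraMap F[X] (RatFunc F) p)) =
        ι (φ (algebraMap F[X] (RatFunc F) p)) := by
      rw [hι, RatFunc.algHom_apply_algebraMap, RatFunc.algHom_apply_algebraMap, hψ, hφ, aeval_def,
        aeval_def, eval₂_map, hom_eval₂]
      congr 1
      ext c
      have := hι (C c)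
      simp only [RatFunc.algebraMap_C, map_C] at this
      simp only [RingHom.comp_apply, RatFunc.algebraMap_eq_C, this]
    rw [← u.num_div_denom]
    simp only [map_div₀, key]
  have hιX : ι RatFunc.X = RatFunc.X := by
    have := hι X
    simpa only [RatFunc.algebraMap_X, map_X] using this
  have hH' : ψ (RatFunc.X ^ m' * ψ (ι H')) = RatFunc.X ^ k := by
    have := congrArg ι hH
    rwa [← hcomm, map_mul, ← hcomm, map_zpow₀, map_pow, hιX] at this
  obtain ⟨x, y, p, q, hx, hy⟩ :=
    monomial_of_algHom_apply_eq_X_pow hcop hdenom hdeg (hψ.trans hιf) hk hH'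
  have hnum := eq_C_mul_X_pow_of_map_eq i hx
  have hden := eq_C_mul_X_pow_of_map_eq i hy
  refine hmon ⟨f.num.coeff p / f.denom.coeff q, p - q, ?_⟩
  conv_lhs => rw [← f.num_div_denom, hnum, hden]
  rw [zpow_sub₀ RatFunc.X_ne_zero]
  simp only [map_mul, map_pow, RatFunc.algebraMap_C, RatFunc.algebraMap_X, map_div₀, zpow_natCast]
  rw [div_mul_div_comm]

theorem zpow_exponents_eq_zero [CharZero F] {f : RatFunc F} (hd : 2 ≤ rdeg f)
    (hmon : ¬ ∃ (a : F) (m : ℤ), f = RatFunc.C a * RatFunc.X ^ m)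
    {φ : RatFunc F →ₐ[F] RatFunc F} (hφ : φ RatFunc.X = f) (n : ℕ) (k : ℕ → ℤ)
    (hrel : ∏ j ∈ Finset.range n, (φ ^ j) RatFunc.X ^ k j = 1) : ∀ j < n, k j = 0 := by
  have hsucc (n : ℕ) (k : ℕ → ℤ) : ∏ j ∈ Finset.range (n + 1), (φ ^ j) RatFunc.X ^ k j =
      RatFunc.X ^ k 0 * φ (∏ j ∈ Finset.range n, (φ ^ j) RatFunc.X ^ k (j + 1)) := by
    rw [Finset.prod_range_succ', mul_comm, map_prod]
    simp only [pow_succ', AlgHom.mul_apply, map_zpow₀, pow_zero, AlgHom.one_apply]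
  induction n generalizing k with
  | zero => simp
  | succ n ih =>
    rw [hsucc] at hrel
    have h0 : k 0 = 0 := by
      rcases n with - | n
      · exact eq_zero_of_X_zpow_mul_eq_one hd hmon hφ (m := 0) (H := 1) (by simpa using hrel)
      · rw [hsucc n fun j => k (j + 1)] at hrel
        exact eq_zero_of_X_zpow_mul_eq_one hd hmon hφ hrel
    have ih' := ih (fun j => k (j + 1)) (by
      apply φ.toRingHom.injective
      change φ _ = φ 1
      simpa [h0] using hrel)
    rintro (- | j) hj
    · exact h0
    · exact ih' j (by omega)

end BaseChange

theorem stmt10 {F : Type*} [Field F] [CharZero F] (f : RatFunc F)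
    (d : ℕ) (hd : rdeg f = d) (hd2 : 2 ≤ d)
    (hmon : ¬ ∃ (a : F) (m : ℤ), f = RatFunc.C a * RatFunc.X ^ m)
    (hconj : ¬ ∃ ψ : RatFunc F, rdeg ψ = 1 ∧ rcomp ψ f = rcomp (RatFunc.X ^ d)⁻¹ ψ)
    (n : ℕ) (k : ℕ → ℤ)
    (h : ∏ i ∈ Finset.Icc 1 n, (riter f i) ^ (k i) = 1) :
    ∀ i ∈ Finset.Icc 1 n, k i = 0 := by
  subst hd
  obtain ⟨φ, hφ⟩ := RatFunc.exists_algHom_apply_X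
    (not_exists_eq_C_of_one_le_rdeg (one_le_two.trans hd2))
  have hrel : ∏ j ∈ Finset.range n, (φ ^ j) RatFunc.X ^ k (j + 1) = 1 := by
    apply φ.toRingHom.injective
    change φ _ = φ 1
    rw [map_one, ← h, ← Finset.Ico_add_one_right_eq_Icc, Finset.prod_Ico_eq_prod_range, map_prod]
    refine Finset.prod_congr (by simp) fun j _ => ?_
    rw [riter_eq_pow_apply_X hφ, map_zpow₀, ← AlgHom.mul_apply, ← pow_succ', add_comm 1 j]
  intro i hi
  obtain ⟨h1, hn⟩ := Finset.mem_Icc.1 hi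
  have := zpow_exponents_eq_zero hd2 hmon hφ n (fun j => k (j + 1)) hrel (i - 1) (by omega)
  simpa [Nat.sub_add_cancel h1] using this
end
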